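/- arXiv:2404.08308 — 2 statements merged into one kernel-verified Lean document; each statement's English description precedes it below -/
import Mathlib

section
/- Let σ : [0,1]² → [0,1] satisfy condition (⋆) and let (X,d_X), (Y,d_Y) be 1-bounded pseudometric spaces. Then for all x,x' ∈ X and y,y' ∈ Y, σ(d_X(x,x'), d_Y(y,y')) equals the supremum, over all nonexpansive functions k₁ : X → [0,1] (with respect to d_X and the Euclidean distance on [0,1]) and all nonexpansive functions k₂ : Y → [0,1] (with respect to d_Y), of |σ(k₁(x), k₂(y)) − σ(k₁(x'), k₂(y'))|. -/
open Set

/-- `d` is a pseudometric: `d x x = 0`, symmetry, and the triangle inequality. -/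
def IsPseudometric {X : Type*} (d : X → X → ℝ) : Prop :=
  (∀ x, d x x = 0) ∧ (∀ x y, d x y = d y x) ∧ (∀ x y z, d x z ≤ d x y + d y z)

/-- `d` is 1-bounded: all values are at most `1`. -/
def IsBounded1 {X : Type*} (d : X → X → ℝ) : Prop := ∀ x y, d x y ≤ 1

theorem IsPseudometric.nonneg {X : Type*} {d : X → X → ℝ} (hd : IsPseudometric d) (x y : X) :
    0 ≤ d x y := by
  have h := hd.2.2 x y x
  rw [hd.1 x, hd.2.1 y x] at h
  linarith

theorem IsPseudometric.abs_sub_le {X : Type*} {d : X → X → ℝ} (hd : IsPseudometric d)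
    (z s t : X) : |d z s - d z t| ≤ d s t := by
  rw [abs_le]
  have h₁ := hd.2.2 z s t
  have h₂ := hd.2.2 z t s
  rw [hd.2.1 t s] at h₂
  constructor <;> linarith

theorem statement_2 {X Y : Type*} (σ : ℝ → ℝ → ℝ)
    (hσmem : ∀ a ∈ Icc (0:ℝ) 1, ∀ b ∈ Icc (0:ℝ) 1, σ a b ∈ Icc (0:ℝ) 1)
    (hmono : ∀ a ∈ Icc (0:ℝ) 1, ∀ b ∈ Icc (0:ℝ) 1, ∀ c ∈ Icc (0:ℝ) 1, ∀ d ∈ Icc (0:ℝ) 1,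
      a ≤ c → b ≤ d → σ a b ≤ σ c d)
    (hzero : σ 0 0 = 0)
    (hstar : ∀ a ∈ Icc (0:ℝ) 1, ∀ b ∈ Icc (0:ℝ) 1, ∀ c ∈ Icc (0:ℝ) 1, ∀ d ∈ Icc (0:ℝ) 1,
      σ a b - σ c d ≤ σ |a - c| |b - d|)
    (dX : X → X → ℝ) (dY : Y → Y → ℝ)
    (hdX : IsPseudometric dX) (hbX : IsBounded1 dX)
    (hdY : IsPseudometric dY) (hbY : IsBounded1 dY)
    (x x' : X) (y y' : Y) :
    σ (dX x x') (dY y y') =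
      sSup {v : ℝ | ∃ k₁ : X → ℝ, ∃ k₂ : Y → ℝ,
        (∀ t, k₁ t ∈ Icc (0:ℝ) 1) ∧ (∀ s t, |k₁ s - k₁ t| ≤ dX s t) ∧
        (∀ t, k₂ t ∈ Icc (0:ℝ) 1) ∧ (∀ s t, |k₂ s - k₂ t| ≤ dY s t) ∧
        v = |σ (k₁ x) (k₂ y) - σ (k₁ x') (k₂ y')|} := by
  have hIX (s t : X) : dX s t ∈ Icc (0:ℝ) 1 := ⟨hdX.nonneg s t, hbX s t⟩
  have hIY (s t : Y) : dY s t ∈ Icc (0:ℝ) 1 := ⟨hdY.nonneg s t, hbY s t⟩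
  symm
  apply IsGreatest.csSup_eq
  constructor
  · refine ⟨dX x', dY y', hIX x', hdX.abs_sub_le x', hIY y', hdY.abs_sub_le y', ?_⟩
    rw [hdX.1, hdY.1, hzero, sub_zero, abs_of_nonneg (hσmem _ (hIX _ _) _ (hIY _ _)).1,
      hdX.2.1 x' x, hdY.2.1 y' y]
  · rintro v ⟨k₁, k₂, hk₁, hn₁, hk₂, hn₂, rfl⟩
    have key (s t : X) (u w : Y) : σ (k₁ s) (k₂ u) - σ (k₁ t) (k₂ w) ≤ σ (dX s t) (dY u w) :=
      (hstar _ (hk₁ s) _ (hk₂ u) _ (hk₁ t) _ (hk₂ w)).trans <|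
        hmono _ ⟨abs_nonneg _, (hn₁ s t).trans (hbX s t)⟩
          _ ⟨abs_nonneg _, (hn₂ u w).trans (hbY u w)⟩
          _ (hIX s t) _ (hIY u w) (hn₁ s t) (hn₂ u w)
    refine abs_sub_le_iff.2 ⟨key x x' y y', ?_⟩
    rw [hdX.2.1 x x', hdY.2.1 y y']
    exact key x' x y' y
end

section
/- Let σ : [0,1]² → [0,1] be monotone and preserve nonempty infima jointly, i.e., σ(inf S, inf T) = inf { σ(s,t) : s ∈ S, t ∈ T } for all nonempty S, T ⊆ [0,1]. Let (X,d₁) and (Y,d₂) be 1-bounded pseudometric spaces and let A₁, A₂ ⊆ X and B₁, B₂ ⊆ Y be nonempty subsets. Define D on X×Y by D((x,y),(x',y')) := σ(d₁(x,x'), d₂(y,y')). Then H(D)(A₁×B₁, A₂×B₂) ≤ σ( H(d₁)(A₁,A₂), H(d₂)(B₁,B₂) ). -/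
open Set

/-- The Hausdorff distance between subsets `A`, `B` with respect to `d`:
`max (sup_{a∈A} inf_{b∈B} d a b) (sup_{b∈B} inf_{a∈A} d a b)`. -/
noncomputable def hausdorffD {Z : Type*} (d : Z → Z → ℝ) (A B : Set Z) : ℝ :=
  max (sSup ((fun a => sInf ((fun b => d a b) '' B)) '' A))
      (sSup ((fun b => sInf ((fun a => d a b) '' A)) '' B))

lemma sInf_image_mem_Icc {Z : Type*} {f : Z → ℝ} (hf : ∀ z, f z ∈ Icc (0:ℝ) 1) {A : Set Z}
    (hA : A.Nonempty) : sInf (f '' A) ∈ Icc (0:ℝ) 1 := by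
  obtain ⟨a, ha⟩ := hA
  refine ⟨Real.sInf_nonneg ?_, (csInf_le ⟨0, ?_⟩ (mem_image_of_mem f ha)).trans (hf a).2⟩ <;>
  · rintro _ ⟨z, -, rfl⟩
    exact (hf z).1

lemma sSup_image_mem_Icc {Z : Type*} {f : Z → ℝ} (hf : ∀ z, f z ∈ Icc (0:ℝ) 1) (A : Set Z) :
    sSup (f '' A) ∈ Icc (0:ℝ) 1 := by
  refine ⟨Real.sSup_nonneg ?_, Real.sSup_le ?_ zero_le_one⟩ <;> rintro _ ⟨z, -, rfl⟩
  · exact (hf z).1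
  · exact (hf z).2

lemma le_sSup_image_of_mem_Icc {Z : Type*} {f : Z → ℝ} (hf : ∀ z, f z ∈ Icc (0:ℝ) 1)
    {A : Set Z} {a : Z} (ha : a ∈ A) : f a ≤ sSup (f '' A) := by
  refine le_csSup ⟨1, ?_⟩ (mem_image_of_mem f ha)
  rintro _ ⟨z, -, rfl⟩
  exact (hf z).2

lemma IsPseudometric.mem_Icc {X : Type*} {d : X → X → ℝ} (hd : IsPseudometric d)
    (hb : IsBounded1 d) (x y : X) : d x y ∈ Icc (0:ℝ) 1 := by
  obtain ⟨h0, hs, ht⟩ := hd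
  refine ⟨?_, hb x y⟩
  have := ht x y x
  rw [h0, hs y x] at this
  linarith

/-- The one-sided Hausdorff distance of products is bounded by any `σ u v` where `u`, `v`
bound the one-sided Hausdorff distances of the factors. -/
lemma sSup_sInf_prod_le {X Y : Type*} (σ : ℝ → ℝ → ℝ)
    (hσmem : ∀ a ∈ Icc (0:ℝ) 1, ∀ b ∈ Icc (0:ℝ) 1, σ a b ∈ Icc (0:ℝ) 1)
    (hmono : ∀ a ∈ Icc (0:ℝ) 1, ∀ b ∈ Icc (0:ℝ) 1, ∀ c ∈ Icc (0:ℝ) 1, ∀ d ∈ Icc (0:ℝ) 1,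
      a ≤ c → b ≤ d → σ a b ≤ σ c d)
    (hinf : ∀ S T : Set ℝ, S.Nonempty → T.Nonempty → S ⊆ Icc (0:ℝ) 1 → T ⊆ Icc (0:ℝ) 1 →
      σ (sInf S) (sInf T) = sInf {x : ℝ | ∃ s ∈ S, ∃ t ∈ T, x = σ s t})
    (f : X → X → ℝ) (g : Y → Y → ℝ)
    (hf : ∀ x x', f x x' ∈ Icc (0:ℝ) 1) (hg : ∀ y y', g y y' ∈ Icc (0:ℝ) 1)
    {A₁ A₂ : Set X} {B₁ B₂ : Set Y} (hA₂ : A₂.Nonempty) (hB₂ : B₂.Nonempty)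
    {u v : ℝ} (hu : u ∈ Icc (0:ℝ) 1) (hv : v ∈ Icc (0:ℝ) 1)
    (hfu : sSup ((fun a => sInf ((fun b => f a b) '' A₂)) '' A₁) ≤ u)
    (hgv : sSup ((fun a => sInf ((fun b => g a b) '' B₂)) '' B₁) ≤ v) :
    sSup ((fun p : X × Y => sInf ((fun q : X × Y => σ (f p.1 q.1) (g p.2 q.2)) '' A₂ ×ˢ B₂)) ''
      A₁ ×ˢ B₁) ≤ σ u v := by
  refine Real.sSup_le ?_ (hσmem u hu v hv).1
  rintro _ ⟨⟨x, y⟩, ⟨hx, hy⟩, rfl⟩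
  have key : sInf ((fun q : X × Y => σ (f x q.1) (g y q.2)) '' A₂ ×ˢ B₂) =
      σ (sInf (f x '' A₂)) (sInf (g y '' B₂)) := by
    rw [hinf _ _ (hA₂.image _) (hB₂.image _) (image_subset_iff.2 fun z _ => hf x z)
      (image_subset_iff.2 fun z _ => hg y z)]
    congr 1
    ext r
    constructor
    · rintro ⟨⟨a, b⟩, ⟨ha, hb⟩, rfl⟩
      exact ⟨_, mem_image_of_mem _ ha, _, mem_image_of_mem _ hb, rfl⟩
    · rintro ⟨_, ⟨a, ha, rfl⟩, _, ⟨b, hb, rfl⟩, rfl⟩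
      exact ⟨(a, b), ⟨ha, hb⟩, rfl⟩
  have hf' : ∀ x, sInf (f x '' A₂) ∈ Icc (0:ℝ) 1 := fun x => sInf_image_mem_Icc (hf x) hA₂
  have hg' : ∀ y, sInf (g y '' B₂) ∈ Icc (0:ℝ) 1 := fun y => sInf_image_mem_Icc (hg y) hB₂
  exact key.trans_le <| hmono _ (hf' x) _ (hg' y) _ hu _ hv
    ((le_sSup_image_of_mem_Icc hf' hx).trans hfu) ((le_sSup_image_of_mem_Icc hg' hy).trans hgv)

lemma hausdorffD_mem_Icc {Z : Type*} {d : Z → Z → ℝ} (hd : ∀ x y, d x y ∈ Icc (0:ℝ) 1)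
    {A B : Set Z} (hA : A.Nonempty) (hB : B.Nonempty) : hausdorffD d A B ∈ Icc (0:ℝ) 1 := by
  have h₁ := sSup_image_mem_Icc (fun a => sInf_image_mem_Icc (fun b => hd a b) hB) A
  have h₂ := sSup_image_mem_Icc (fun b => sInf_image_mem_Icc (fun a => hd a b) hA) B
  exact ⟨h₁.1.trans (le_max_left _ _), max_le h₁.2 h₂.2⟩

theorem statement_11 {X Y : Type*} (σ : ℝ → ℝ → ℝ)
    (hσmem : ∀ a ∈ Icc (0:ℝ) 1, ∀ b ∈ Icc (0:ℝ) 1, σ a b ∈ Icc (0:ℝ) 1)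
    (hmono : ∀ a ∈ Icc (0:ℝ) 1, ∀ b ∈ Icc (0:ℝ) 1, ∀ c ∈ Icc (0:ℝ) 1, ∀ d ∈ Icc (0:ℝ) 1,
      a ≤ c → b ≤ d → σ a b ≤ σ c d)
    -- σ preserves nonempty infima jointly
    (hinf : ∀ S T : Set ℝ, S.Nonempty → T.Nonempty → S ⊆ Icc (0:ℝ) 1 → T ⊆ Icc (0:ℝ) 1 →
      σ (sInf S) (sInf T) = sInf {x : ℝ | ∃ s ∈ S, ∃ t ∈ T, x = σ s t})
    (d₁ : X → X → ℝ) (d₂ : Y → Y → ℝ)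
    (hd₁ : IsPseudometric d₁) (hb₁ : IsBounded1 d₁)
    (hd₂ : IsPseudometric d₂) (hb₂ : IsBounded1 d₂)
    (A₁ A₂ : Set X) (B₁ B₂ : Set Y)
    (hA₁ : A₁.Nonempty) (hA₂ : A₂.Nonempty) (hB₁ : B₁.Nonempty) (hB₂ : B₂.Nonempty) :
    hausdorffD (fun p q : X × Y => σ (d₁ p.1 q.1) (d₂ p.2 q.2)) (A₁ ×ˢ B₁) (A₂ ×ˢ B₂) ≤
      σ (hausdorffD d₁ A₁ A₂) (hausdorffD d₂ B₁ B₂) := by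
  have h₁ := hd₁.mem_Icc hb₁
  have h₂ := hd₂.mem_Icc hb₂
  have hu := hausdorffD_mem_Icc h₁ hA₁ hA₂
  have hv := hausdorffD_mem_Icc h₂ hB₁ hB₂
  exact max_le
    (sSup_sInf_prod_le σ hσmem hmono hinf d₁ d₂ h₁ h₂ hA₂ hB₂ hu hv
      (le_max_left _ _) (le_max_left _ _))
    (sSup_sInf_prod_le σ hσmem hmono hinf (fun a b => d₁ b a) (fun a b => d₂ b a)
      (fun a b => h₁ b a) (fun a b => h₂ b a) hA₁ hB₁ hu hv
      (le_max_right _ _) (le_max_right _ _))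
end
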